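/- arXiv:1610.06473 — 3 statements merged into one kernel-verified Lean document; each statement's English description precedes it below -/
import Mathlib

section
/- A function F : L([0,1])² → L([0,1]) is migrative if and only if the function g_F : L([0,1]) → L([0,1]) defined by g_F(X) = F([1,1], X) satisfies F(X, Y) = g_F(XY) for all X, Y ∈ L([0,1]). -/
/-! Closed subintervals of the unit interval, interval-valued overlap functions,
and related notions. -/

/-- The set `L([0,1])` of closed subintervals `[lo, hi]` of `[0,1]`. -/
@[ext]
structure IV : Type where
  lo : ℝ
  hi : ℝ
  lo_nonneg : 0 ≤ lo
  lo_le_hi : lo ≤ hi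
  hi_le_one : hi ≤ 1

namespace IV

/-- The degenerate interval `[0,0]`. -/
instance : Zero IV := ⟨⟨0, 0, le_refl 0, le_refl 0, zero_le_one⟩⟩

/-- The degenerate interval `[1,1]`. -/
instance : One IV := ⟨⟨1, 1, zero_le_one, le_refl 1, le_refl 1⟩⟩

/-- Interval product: `X * Y = [x̲·y̲, x̄·ȳ]`. -/
instance : Mul IV :=
  ⟨fun X Y =>
    ⟨X.lo * Y.lo, X.hi * Y.hi, mul_nonneg X.lo_nonneg Y.lo_nonneg,
      mul_le_mul X.lo_le_hi Y.lo_le_hi Y.lo_nonneg (X.lo_nonneg.trans X.lo_le_hi),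
      mul_le_one₀ X.hi_le_one (Y.lo_nonneg.trans Y.lo_le_hi) Y.hi_le_one⟩⟩

/-- The product (componentwise) order on intervals. -/
instance : LE IV := ⟨fun X Y => X.lo ≤ Y.lo ∧ X.hi ≤ Y.hi⟩

/-- Componentwise maximum of intervals: `X ∨ Y`. -/
instance : Max IV :=
  ⟨fun X Y =>
    ⟨max X.lo Y.lo, max X.hi Y.hi, le_max_of_le_left X.lo_nonneg,
      max_le_max X.lo_le_hi Y.lo_le_hi, max_le X.hi_le_one Y.hi_le_one⟩⟩

/-- Componentwise minimum of intervals: `X ∧ Y`. -/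
instance : Min IV :=
  ⟨fun X Y =>
    ⟨min X.lo Y.lo, min X.hi Y.hi, le_min X.lo_nonneg Y.lo_nonneg,
      min_le_min X.lo_le_hi Y.lo_le_hi, min_le_of_left_le X.hi_le_one⟩⟩

/-- Interval inclusion: `X ⊆ Y`. -/
def subs (X Y : IV) : Prop := Y.lo ≤ X.lo ∧ X.hi ≤ Y.hi

/-- The Moore metric on intervals. -/
noncomputable def mdist (X Y : IV) : ℝ := max |X.lo - Y.lo| |X.hi - Y.hi|

/-- Interval power with natural exponent: `Xⁿ = [x̲ⁿ, x̄ⁿ]`. -/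
def npow (X : IV) (n : ℕ) : IV :=
  ⟨X.lo ^ n, X.hi ^ n, pow_nonneg X.lo_nonneg n,
    pow_le_pow_left₀ X.lo_nonneg X.lo_le_hi n,
    pow_le_one₀ (X.lo_nonneg.trans X.lo_le_hi) X.hi_le_one⟩

/-- Interval `n`-th root: `X^{1/n} = [x̲^{1/n}, x̄^{1/n}]`. -/
noncomputable def nroot (X : IV) (n : ℕ) : IV :=
  ⟨X.lo ^ ((n : ℝ))⁻¹, X.hi ^ ((n : ℝ))⁻¹,
    Real.rpow_nonneg X.lo_nonneg _,
    Real.rpow_le_rpow X.lo_nonneg X.lo_le_hi (by positivity),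
    Real.rpow_le_one (X.lo_nonneg.trans X.lo_le_hi) X.hi_le_one (by positivity)⟩

/-- Interval complement: `Xᶜ = [1 - x̄, 1 - x̲]`. -/
def compl (X : IV) : IV :=
  ⟨1 - X.hi, 1 - X.lo, by linarith [X.hi_le_one], by linarith [X.lo_le_hi],
    by linarith [X.lo_nonneg]⟩

/-- Interval power with interval exponent `K = [k₁,k₂]`, `0 < k₁ ≤ k₂`:
`X^K = [x̲^{k₂}, x̄^{k₁}]`. -/
noncomputable def ipow (X : IV) (k₁ k₂ : ℝ) (hk₁ : 0 < k₁) (hk : k₁ ≤ k₂) : IV :=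
  ⟨X.lo ^ k₂, X.hi ^ k₁,
    Real.rpow_nonneg X.lo_nonneg _,
    by
      rcases eq_or_lt_of_le X.lo_nonneg with h | h
      · rw [← h, Real.zero_rpow (by linarith : k₂ ≠ 0)]
        exact Real.rpow_nonneg (X.lo_nonneg.trans X.lo_le_hi) _
      · calc X.lo ^ k₂ ≤ X.lo ^ k₁ :=
              Real.rpow_le_rpow_of_exponent_ge h (X.lo_le_hi.trans X.hi_le_one) hk
          _ ≤ X.hi ^ k₁ := Real.rpow_le_rpow X.lo_nonneg X.lo_le_hi hk₁.le,
    Real.rpow_le_one (X.lo_nonneg.trans X.lo_le_hi) X.hi_le_one hk₁.le⟩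

end IV

/-- The unit interval `[0,1]` of real numbers. -/
abbrev I01 := unitInterval

/-- The degenerate interval `[x,x]`. -/
def IV.diag (x : I01) : IV := ⟨x, x, x.2.1, le_refl _, x.2.2⟩

/-- The left endpoint, as an element of `[0,1]`. -/
def IV.loI (X : IV) : I01 := ⟨X.lo, X.lo_nonneg, X.lo_le_hi.trans X.hi_le_one⟩

/-- The right endpoint, as an element of `[0,1]`. -/
def IV.hiI (X : IV) : I01 := ⟨X.hi, X.lo_nonneg.trans X.lo_le_hi, X.hi_le_one⟩

/-- Moore continuity of a unary interval function. -/
def MooreCont1 (g : IV → IV) : Prop :=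
  ∀ X : IV, ∀ ε > (0 : ℝ), ∃ δ > (0 : ℝ), ∀ Y : IV,
    IV.mdist X Y < δ → IV.mdist (g X) (g Y) < ε

/-- Moore continuity of a binary interval function. -/
def MooreCont2 (O : IV → IV → IV) : Prop :=
  ∀ X Y : IV, ∀ ε > (0 : ℝ), ∃ δ > (0 : ℝ), ∀ X' Y' : IV,
    IV.mdist X X' < δ → IV.mdist Y Y' < δ → IV.mdist (O X Y) (O X' Y') < ε

/-- Interval-valued overlap function. -/
structure IVOverlap (O : IV → IV → IV) : Prop where
  comm : ∀ X Y, O X Y = O Y X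
  zero_iff : ∀ X Y, O X Y = 0 ↔ X * Y = 0
  one_iff : ∀ X Y, O X Y = 1 ↔ X * Y = 1
  mono : ∀ X Y Z, Y ≤ Z → O X Y ≤ O X Z
  cont : MooreCont2 O

/-- Migrativity of a binary interval function. -/
def Migrative (F : IV → IV → IV) : Prop := ∀ α X Y : IV, F (α * X) Y = F X (α * Y)

/-- (Real-valued) overlap function on `[0,1]`. -/
structure Overlap (G : I01 → I01 → I01) : Prop where
  comm : ∀ x y, G x y = G y x
  zero_iff : ∀ x y, G x y = 0 ↔ x * y = 0
  one_iff : ∀ x y, G x y = 1 ↔ x * y = 1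
  mono : ∀ x y z, y ≤ z → G x y ≤ G x z
  cont : Continuous (Function.uncurry G)

/-- Left projection of a binary interval function. -/
def lproj (O : IV → IV → IV) (x y : I01) : I01 := (O (IV.diag x) (IV.diag y)).loI

/-- Right projection of a binary interval function. -/
def rproj (O : IV → IV → IV) (x y : I01) : I01 := (O (IV.diag x) (IV.diag y)).hiI

/-- `O(X,Y) = [G₁(x̲,y̲), G₂(x̄,ȳ)]` for all `X, Y`. -/
def Represents (G₁ G₂ : I01 → I01 → I01) (O : IV → IV → IV) : Prop :=
  ∀ X Y : IV, (O X Y).lo = (G₁ X.loI Y.loI : ℝ) ∧ (O X Y).hi = (G₂ X.hiI Y.hiI : ℝ)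

/-- o-representability of an interval-valued overlap function. -/
def ORepresentable (O : IV → IV → IV) : Prop :=
  ∃ G₁ G₂ : I01 → I01 → I01, Overlap G₁ ∧ Overlap G₂ ∧
    (∀ x y, G₁ x y ≤ G₂ x y) ∧ Represents G₁ G₂ O

/-- Interval-valued t-norm. -/
structure IVTnorm (T : IV → IV → IV) : Prop where
  comm : ∀ X Y, T X Y = T Y X
  assoc : ∀ X Y Z, T X (T Y Z) = T (T X Y) Z
  mono : ∀ X Y Z, Y ≤ Z → T X Y ≤ T X Z
  one : ∀ X, T X 1 = X

namespace IV

theorem mul_comm' (X Y : IV) : X * Y = Y * X :=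
  IV.ext (mul_comm X.lo Y.lo) (mul_comm X.hi Y.hi)

theorem mul_assoc' (X Y Z : IV) : X * Y * Z = X * (Y * Z) :=
  IV.ext (mul_assoc X.lo Y.lo Z.lo) (mul_assoc X.hi Y.hi Z.hi)

theorem mul_one' (X : IV) : X * 1 = X :=
  IV.ext (mul_one X.lo) (mul_one X.hi)

end IV

/-- `F` is migrative iff `g_F(X) = F([1,1],X)` satisfies
`F(X,Y) = g_F(XY)` for all `X, Y`. -/
theorem stmt_1 (F : IV → IV → IV) (gF : IV → IV) (hgF : ∀ X : IV, gF X = F 1 X) :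
    Migrative F ↔ ∀ X Y : IV, F X Y = gF (X * Y) := by
  constructor
  · intro h X Y
    rw [hgF, ← h X 1 Y, IV.mul_one']
  · intro h α X Y
    rw [h, h, IV.mul_comm' α X, IV.mul_assoc']
end

section
/- Let F : L([0,1])² → L([0,1]) be a migrative function. Then F is homogeneous of order [1,1] (F(αX, αY) = α·F(X,Y) for all α, X, Y, with F([1,1],[1,1]) = [1,1]) if and only if F is idempotent (F(X,X) = X for all X). -/
namespace IV

instance : CommMonoid IV where
  mul_assoc X Y Z := IV.ext (mul_assoc X.lo Y.lo Z.lo) (mul_assoc X.hi Y.hi Z.hi)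
  one_mul X := IV.ext (one_mul X.lo) (one_mul X.hi)
  mul_one X := IV.ext (mul_one X.lo) (mul_one X.hi)
  mul_comm X Y := IV.ext (mul_comm X.lo Y.lo) (mul_comm X.hi Y.hi)

/-- Every interval has a square root for the interval product. -/
theorem exists_mul_self_eq (X : IV) : ∃ S : IV, S * S = X :=
  ⟨⟨√X.lo, √X.hi, Real.sqrt_nonneg _, Real.sqrt_le_sqrt X.lo_le_hi,
      Real.sqrt_le_one.mpr X.hi_le_one⟩,
    IV.ext (Real.mul_self_sqrt X.lo_nonneg)
      (Real.mul_self_sqrt (X.lo_nonneg.trans X.lo_le_hi))⟩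

end IV

/-- A migrative function depends only on the product of its arguments. -/
theorem Migrative.eq_one_mul {F : IV → IV → IV} (hF : Migrative F) (X Y : IV) :
    F X Y = F 1 (X * Y) := by
  simpa using hF X 1 Y

/-- An idempotent migrative function sends `(X, Y)` to the square root of `X * Y`. -/
theorem Migrative.eq_of_mul_self_eq {F : IV → IV → IV} (hF : Migrative F)
    (hid : ∀ X : IV, F X X = X) {S X Y : IV} (h : S * S = X * Y) : F X Y = S := by
  rw [hF.eq_one_mul, ← h, ← hF.eq_one_mul, hid]

/-- a migrative interval function is homogeneous of order `[1,1]`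
(with `F([1,1],[1,1]) = [1,1]`) iff it is idempotent. -/
theorem stmt_13 (F : IV → IV → IV) (hmig : Migrative F) :
    ((∀ α X Y : IV, F (α * X) (α * Y) = α * F X Y) ∧ F 1 1 = 1) ↔
      (∀ X : IV, F X X = X) := by
  constructor
  · rintro ⟨hhom, hone⟩ X
    simpa [hone] using hhom X 1 1
  · refine fun hid => ⟨fun α X Y => ?_, hid 1⟩
    obtain ⟨S, hS⟩ := IV.exists_mul_self_eq (X * Y)
    rw [hmig.eq_of_mul_self_eq hid hS]
    apply hmig.eq_of_mul_self_eq hid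
    rw [mul_mul_mul_comm, hS, mul_mul_mul_comm]
end

section
/- A function O : L([0,1])² → L([0,1]) is a migrative interval-valued overlap function if and only if there exists a monotone (with respect to the product order) and Moore continuous function g : L([0,1]) → L([0,1]) such that O(X,Y) = g(XY) for all X, Y ∈ L([0,1]), g([0,0]) = [0,0], g([1,1]) = [1,1], and g(X) ∉ {[0,0], [1,1]} whenever X ∉ {[0,0], [1,1]}. -/
namespace IV

theorem one_mul' (X : IV) : 1 * X = X :=
  IV.ext (one_mul X.lo) (one_mul X.hi)

theorem zero_ne_one' : (0 : IV) ≠ 1 := fun h =>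
  zero_ne_one (α := ℝ) (congrArg IV.lo h)

theorem mul_le_mul_left' (X : IV) {Y Z : IV} (h : Y ≤ Z) : X * Y ≤ X * Z :=
  ⟨mul_le_mul_of_nonneg_left h.1 X.lo_nonneg,
    mul_le_mul_of_nonneg_left h.2 (X.lo_nonneg.trans X.lo_le_hi)⟩

theorem mdist_self (X : IV) : mdist X X = 0 := by simp [mdist]

theorem abs_mul_sub_mul_le {x y x' y' : ℝ} (hy : 0 ≤ y) (hy1 : y ≤ 1) (hx : 0 ≤ x')
    (hx1 : x' ≤ 1) : |x * y - x' * y'| ≤ |x - x'| + |y - y'| := by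
  have h : x * y - x' * y' = (x - x') * y + x' * (y - y') := by ring
  rw [h]
  refine (abs_add_le _ _).trans (add_le_add ?_ ?_)
  · rw [abs_mul, abs_of_nonneg hy]
    exact mul_le_of_le_one_right (abs_nonneg _) hy1
  · rw [abs_mul, abs_of_nonneg hx]
    exact mul_le_of_le_one_left (abs_nonneg _) hx1

theorem mdist_mul_le (X Y X' Y' : IV) :
    mdist (X * Y) (X' * Y') ≤ mdist X X' + mdist Y Y' :=
  max_le
    ((abs_mul_sub_mul_le Y.lo_nonneg (Y.lo_le_hi.trans Y.hi_le_one) X'.lo_nonneg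
      (X'.lo_le_hi.trans X'.hi_le_one)).trans (add_le_add (le_max_left _ _) (le_max_left _ _)))
    ((abs_mul_sub_mul_le (Y.lo_nonneg.trans Y.lo_le_hi) Y.hi_le_one
      (X'.lo_nonneg.trans X'.lo_le_hi) X'.hi_le_one).trans
      (add_le_add (le_max_right _ _) (le_max_right _ _)))

end IV

/-- characterization of migrative interval-valued overlap
functions via a monotone Moore-continuous function `g` with `O(X,Y) = g(XY)`. -/
theorem stmt_14 (O : IV → IV → IV) :
    (IVOverlap O ∧ Migrative O) ↔
      ∃ g : IV → IV, (∀ X Y : IV, X ≤ Y → g X ≤ g Y) ∧ MooreCont1 g ∧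
        (∀ X Y : IV, O X Y = g (X * Y)) ∧ g 0 = 0 ∧ g 1 = 1 ∧
        (∀ X : IV, X ≠ 0 → X ≠ 1 → g X ≠ 0 ∧ g X ≠ 1) := by
  constructor
  · rintro ⟨hO, hM⟩
    have zero_iff (X : IV) : O 1 X = 0 ↔ X = 0 := by rw [hO.zero_iff, IV.one_mul']
    have one_iff (X : IV) : O 1 X = 1 ↔ X = 1 := by rw [hO.one_iff, IV.one_mul']
    refine ⟨O 1, hO.mono 1, ?_, ?_, (zero_iff 0).2 rfl, (one_iff 1).2 rfl,
      fun X h0 h1 => ⟨mt (zero_iff X).1 h0, mt (one_iff X).1 h1⟩⟩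
    · intro X ε hε
      obtain ⟨δ, hδ, h⟩ := hO.cont 1 X ε hε
      exact ⟨δ, hδ, fun Y hY => h 1 Y (by rwa [IV.mdist_self]) hY⟩
    · intro X Y
      rw [← hM X 1 Y, IV.mul_one']
  · rintro ⟨g, hmono, hcont, hg, h0, h1, hne⟩
    have zero_iff (X : IV) : g X = 0 ↔ X = 0 := by
      refine ⟨fun h => by_contra fun hX => ?_, fun h => h ▸ h0⟩
      by_cases hX1 : X = 1
      · subst hX1
        exact IV.zero_ne_one' (h.symm.trans h1)
      · exact (hne X hX hX1).1 h
    have one_iff (X : IV) : g X = 1 ↔ X = 1 := by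
      refine ⟨fun h => by_contra fun hX => ?_, fun h => h ▸ h1⟩
      by_cases hX0 : X = 0
      · subst hX0
        exact IV.zero_ne_one' (h0.symm.trans h)
      · exact (hne X hX0 hX).2 h
    refine ⟨⟨?_, ?_, ?_, ?_, ?_⟩, ?_⟩
    · intro X Y
      rw [hg, hg, IV.mul_comm']
    · intro X Y
      rw [hg, zero_iff]
    · intro X Y
      rw [hg, one_iff]
    · intro X Y Z h
      rw [hg, hg]
      exact hmono _ _ (IV.mul_le_mul_left' X h)
    · intro X Y ε hε
      obtain ⟨δ, hδ, h⟩ := hcont (X * Y) ε hε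
      refine ⟨δ / 2, half_pos hδ, fun X' Y' hX hY => ?_⟩
      rw [hg, hg]
      exact h _ ((IV.mdist_mul_le X Y X' Y').trans_lt (by linarith))
    · intro α X Y
      rw [hg, hg, IV.mul_comm' α X, IV.mul_assoc']
end
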